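/- arXiv:2011.13919 — 6 statements merged into one kernel-verified Lean document; each statement's English description precedes it below -/
import Mathlib

section
/- For every real q with 0 < q < 1, both the even and the odd cat-state energy distributions have the same variance: (∑_{n even} n² q^n)/(∑_{n even} q^n) − ((∑_{n even} n q^n)/(∑_{n even} q^n))² = 4q²/((1 − q)²(1 + q)²), and the same identity holds with all sums taken over odd n. With q = |Λ|², this says (ΔE)²_{Cat±(Λ)} = 4|Λ|⁴/((1 − |Λ|²)²(1 + |Λ|²)²). -/
/-- The second moment of the geometric distribution, up to normalization. -/
lemma hasSum_coe_sq_mul_geometric {x : ℝ} (hx : ‖x‖ < 1) :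
    HasSum (fun m : ℕ ↦ (m : ℝ) ^ 2 * x ^ m) (x * (1 + x) / (1 - x) ^ 3) := by
  have hx1 : 1 - x ≠ 0 := sub_ne_zero.2 (lt_of_abs_lt hx).ne'
  convert! (((hasSum_choose_mul_geometric_of_norm_lt_one 2 hx).mul_left 2).sub
    ((hasSum_coe_mul_geometric_of_norm_lt_one hx).mul_left 3)).sub
    ((hasSum_geometric_of_norm_lt_one hx).mul_left 2) using 1
  · funext m
    rw [Nat.cast_choose_two]
    push_cast
    ring
  · field_simp
    ring

/-- The variance of `a * m + b` when `m` is geometrically distributed with ratio `x`; the common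
factor `c` of the weights cancels. -/
lemma affine_geometric_variance {x c : ℝ} (hx : ‖x‖ < 1) (hc : c ≠ 0) (a b : ℝ) :
    (∑' m : ℕ, (a * m + b) ^ 2 * (c * x ^ m)) / (∑' m : ℕ, c * x ^ m)
        - ((∑' m : ℕ, (a * m + b) * (c * x ^ m)) / (∑' m : ℕ, c * x ^ m)) ^ 2
      = a ^ 2 * x / (1 - x) ^ 2 := by
  have hx1 : 1 - x ≠ 0 := sub_ne_zero.2 (lt_of_abs_lt hx).ne'
  have s0 := hasSum_geometric_of_norm_lt_one hx
  have s1 := hasSum_coe_mul_geometric_of_norm_lt_one hx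
  have s2 := hasSum_coe_sq_mul_geometric hx
  have first : HasSum (fun m : ℕ ↦ (a * m + b) * (c * x ^ m))
      (c * a * (x / (1 - x) ^ 2) + c * b * (1 - x)⁻¹) := by
    convert! (s1.mul_left (c * a)).add (s0.mul_left (c * b)) using 2
    ring
  have second : HasSum (fun m : ℕ ↦ (a * m + b) ^ 2 * (c * x ^ m))
      (c * a ^ 2 * (x * (1 + x) / (1 - x) ^ 3) + c * (2 * a * b) * (x / (1 - x) ^ 2)
        + c * b ^ 2 * (1 - x)⁻¹) := by
    convert! ((s2.mul_left (c * a ^ 2)).add (s1.mul_left (c * (2 * a * b)))).add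
      (s0.mul_left (c * b ^ 2)) using 2
    ring
  rw [first.tsum_eq, second.tsum_eq, (s0.mul_left c).tsum_eq]
  field_simp
  ring


/-- For every real `q` with `0 < q < 1`, both the even and the odd cat-state
energy distributions have the same variance:
`(∑_{n even} n² qⁿ)/(∑_{n even} qⁿ) − ((∑_{n even} n qⁿ)/(∑_{n even} qⁿ))² = 4q²/((1−q)²(1+q)²)`,
and the same identity holds with all sums taken over odd `n`.  With `q = |Λ|²` this says
`(ΔE)²_{Cat±(Λ)} = 4|Λ|⁴/((1 − |Λ|²)²(1 + |Λ|²)²)`. -/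
theorem cat_state_energy_variance (q : ℝ) (h0 : 0 < q) (h1 : q < 1) :
    (∑' m : ℕ, ((2 * m : ℕ) : ℝ) ^ 2 * q ^ (2 * m)) / (∑' m : ℕ, q ^ (2 * m))
        - ((∑' m : ℕ, ((2 * m : ℕ) : ℝ) * q ^ (2 * m)) / (∑' m : ℕ, q ^ (2 * m))) ^ 2
      = 4 * q ^ 2 / ((1 - q) ^ 2 * (1 + q) ^ 2) ∧
    (∑' m : ℕ, ((2 * m + 1 : ℕ) : ℝ) ^ 2 * q ^ (2 * m + 1)) / (∑' m : ℕ, q ^ (2 * m + 1))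
        - ((∑' m : ℕ, ((2 * m + 1 : ℕ) : ℝ) * q ^ (2 * m + 1)) / (∑' m : ℕ, q ^ (2 * m + 1))) ^ 2
      = 4 * q ^ 2 / ((1 - q) ^ 2 * (1 + q) ^ 2) := by
  have hx : ‖q ^ 2‖ < 1 := by
    rw [Real.norm_of_nonneg (sq_nonneg q)]
    exact pow_lt_one₀ h0.le h1 two_ne_zero
  have hrhs : 4 * q ^ 2 / ((1 - q) ^ 2 * (1 + q) ^ 2) = 2 ^ 2 * q ^ 2 / (1 - q ^ 2) ^ 2 := by
    rw [← mul_pow]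
    ring
  rw [hrhs]
  constructor
  · simpa [pow_mul] using affine_geometric_variance hx one_ne_zero 2 0
  · simpa [pow_succ', pow_mul] using affine_geometric_variance hx h0.ne' 2 1
end

section
/- For every positive integer N, every integer n with 0 ≤ n ≤ N−1, and every complex Λ with |Λ| < 1, the normalization of the N-state Schrödinger cat satisfies 𝒩_{N,n} = ∑_{m=0}^{N−1} ∑_{m'=0}^{N−1} e^{−2πi(m−m')n/N} / (1 − |Λ|² e^{2πi(m−m')/N}) = N² |Λ|^{2n} / (1 − |Λ|^{2N}). -/
theorem inv_one_sub_mul_eq_sum_div {K : Type*} [Field K] {N : ℕ} {x w : K}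
    (hw : w ^ N = 1) (hx : x ^ N ≠ 1) :
    (1 - x * w)⁻¹ = (∑ k ∈ Finset.range N, (x * w) ^ k) / (1 - x ^ N) := by
  have key := mul_neg_geom_sum (x * w) N
  rw [mul_pow, hw, mul_one] at key
  have hd : 1 - x ^ N ≠ 0 := sub_ne_zero.mpr hx.symm
  have h1 : 1 - x * w ≠ 0 := fun h0 => hd (by rw [← key, h0, zero_mul])
  rw [eq_div_iff hd, ← key, inv_mul_cancel_left₀ h1]

theorem IsPrimitiveRoot.sum_div_pow_pow {K : Type*} [Field K] {N k n : ℕ} {ζ : K}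
    (hζ : IsPrimitiveRoot ζ N) (hk : k < N) (hn : n < N) :
    ∑ m ∈ Finset.range N, (ζ ^ k / ζ ^ n) ^ m = if k = n then (N : K) else 0 := by
  have h0 : ζ ≠ 0 := hζ.ne_zero (by lia)
  split_ifs with h
  · simp [h, div_self (pow_ne_zero n h0)]
  · have hc : ζ ^ k / ζ ^ n ≠ 1 := fun hc =>
      h (hζ.pow_inj hk hn ((div_eq_one_iff_eq (pow_ne_zero n h0)).mp hc))
    rw [geom_sum_eq hc, div_pow, ← pow_mul, ← pow_mul, mul_comm k, mul_comm n, pow_mul, pow_mul,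
      hζ.pow_eq_one]
    simp

theorem IsPrimitiveRoot.sum_sum_inv_pow_div_one_sub_mul {K : Type*} [Field K] {N n : ℕ} {ζ x : K}
    (hζ : IsPrimitiveRoot ζ N) (hn : n < N) (hx : x ^ N ≠ 1) :
    ∑ m ∈ Finset.range N, ∑ m' ∈ Finset.range N,
        ((ζ ^ m / ζ ^ m') ^ n)⁻¹ / (1 - x * (ζ ^ m / ζ ^ m'))
      = (N : K) ^ 2 * x ^ n / (1 - x ^ N) := by
  have h0 : ζ ≠ 0 := hζ.ne_zero (by lia)
  have hterm (m m' : ℕ) : ((ζ ^ m / ζ ^ m') ^ n)⁻¹ / (1 - x * (ζ ^ m / ζ ^ m'))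
      = (∑ k ∈ Finset.range N, x ^ k * ((ζ ^ k / ζ ^ n) ^ m * (ζ ^ n / ζ ^ k) ^ m'))
        / (1 - x ^ N) := by
    have hw : (ζ ^ m / ζ ^ m') ^ N = 1 := by
      rw [div_pow, ← pow_mul, ← pow_mul, mul_comm m, mul_comm m', pow_mul, pow_mul, hζ.pow_eq_one]
      simp
    rw [div_eq_mul_inv, inv_one_sub_mul_eq_sum_div hw hx, ← mul_div_assoc, Finset.mul_sum]
    congr 1
    refine Finset.sum_congr rfl fun k _ => ?_
    simp only [mul_pow, div_pow, ← pow_mul]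
    field_simp
    ring
  have hinner (k : ℕ) (hk : k ∈ Finset.range N) :
      ∑ m ∈ Finset.range N, ∑ m' ∈ Finset.range N,
        x ^ k * ((ζ ^ k / ζ ^ n) ^ m * (ζ ^ n / ζ ^ k) ^ m')
      = if k = n then (N : K) ^ 2 * x ^ n else 0 := by
    have hk' := Finset.mem_range.mp hk
    simp_rw [← Finset.mul_sum, ← Finset.sum_mul]
    rw [hζ.sum_div_pow_pow hk' hn, hζ.sum_div_pow_pow hn hk']
    split_ifs with h h' h'
    · rw [h]; ring
    · exact absurd h.symm h'
    · simp
    · simp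
  simp_rw [hterm, ← Finset.sum_div]
  congr 1
  rw [Finset.sum_congr rfl fun m _ => Finset.sum_comm, Finset.sum_comm,
    Finset.sum_congr rfl hinner, Finset.sum_ite_eq', if_pos (Finset.mem_range.mpr hn)]

/-- For every positive integer `N`, every integer `n` with `0 ≤ n ≤ N−1`, and
every complex `Λ` with `|Λ| < 1`, the normalization of the `N`-state Schrödinger cat satisfies
`𝒩_{N,n} = ∑_{m,m'=0}^{N−1} e^{−2πi(m−m')n/N} / (1 − |Λ|² e^{2πi(m−m')/N})
         = N² |Λ|^{2n} / (1 − |Λ|^{2N})`. -/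
theorem N_cat_normalization (N : ℕ) (hN : 0 < N) (n : ℕ) (hn : n < N) (Λ : ℂ) (h : ‖Λ‖ < 1) :
    (∑ m ∈ Finset.range N, ∑ m' ∈ Finset.range N,
        Complex.exp (-(2 * (Real.pi : ℂ) * Complex.I * ((m : ℂ) - (m' : ℂ)) * (n : ℂ) / (N : ℂ)))
          / (1 - ((‖Λ‖ ^ 2 : ℝ) : ℂ) *
              Complex.exp (2 * (Real.pi : ℂ) * Complex.I * ((m : ℂ) - (m' : ℂ)) / (N : ℂ))))
      = (N : ℂ) ^ 2 * (‖Λ‖ : ℂ) ^ (2 * n) / (1 - (‖Λ‖ : ℂ) ^ (2 * N)) := by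
  have hN0 : (N : ℂ) ≠ 0 := Nat.cast_ne_zero.mpr hN.ne'
  have hx : ((‖Λ‖ : ℂ) ^ 2) ^ N ≠ 1 := by
    have hlt : (‖Λ‖ ^ 2) ^ N < 1 :=
      pow_lt_one₀ (by positivity) (pow_lt_one₀ (norm_nonneg Λ) h two_ne_zero) hN.ne'
    exact_mod_cast hlt.ne
  rw [pow_mul, pow_mul,
    ← (Complex.isPrimitiveRoot_exp N hN.ne').sum_sum_inv_pow_div_one_sub_mul hn hx]
  refine Finset.sum_congr rfl fun m _ => Finset.sum_congr rfl fun m' _ => ?_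
  rw [← Complex.exp_nat_mul, ← Complex.exp_nat_mul, ← Complex.exp_sub, ← Complex.exp_nat_mul,
    ← Complex.exp_neg, Complex.ofReal_pow]
  congr 3
  · ring
  · congr 2
    ring
end

section
/- For every positive integer N, every integer n with 0 ≤ n ≤ N−1, and every complex Λ with 0 < |Λ| < 1, the mean excitation energy of the N-state Schrödinger cat Φ = ∑_{m=0}^{N−1} e^{−2πimn/N} Coh(Λe^{2πim/N}) ∈ ℓ²(ℕ, ℂ) is ⟨Ê⟩_Φ = (n + (N − n)|Λ|^{2N})/(1 − |Λ|^{2N}). -/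
theorem IsPrimitiveRoot.sum_range_pow_mul_inv_pow {K : Type*} [Field K] {ζ : K} {N : ℕ}
    (hζ : IsPrimitiveRoot ζ N) (n j : ℕ) :
    ∑ m ∈ Finset.range N, (ζ ^ j * (ζ ^ n)⁻¹) ^ m = if j ≡ n [MOD N] then (N : K) else 0 := by
  rcases Nat.eq_zero_or_pos N with rfl | hN
  · simp
  have hζ0 : ζ ^ n ≠ 0 := pow_ne_zero _ (hζ.ne_zero hN.ne')
  have h1 : ζ ^ j * (ζ ^ n)⁻¹ = 1 ↔ j ≡ n [MOD N] := by
    rw [mul_inv_eq_one₀ hζ0, (hζ.isOfFinOrder hN.ne').pow_eq_pow_iff_modEq, ← hζ.eq_orderOf]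
  split_ifs with h
  · simp [h1.2 h]
  · have hw : (ζ ^ j * (ζ ^ n)⁻¹) ^ N = 1 := by
      rw [mul_pow, inv_pow, pow_right_comm, pow_right_comm ζ n, hζ.pow_eq_one]
      simp
    rw [geom_sum_eq (mt h1.1 h), hw, sub_self, zero_div]

theorem tsum_eq_tsum_add_mul_of_modEq {N n : ℕ} (hn : n < N) (f : ℕ → ℝ)
    (hf : ∀ j, ¬ j ≡ n [MOD N] → f j = 0) : ∑' j, f j = ∑' k, f (n + N * k) := by
  have hinj : Function.Injective fun k => n + N * k := fun a b h =>
    Nat.eq_of_mul_eq_mul_left (by omega : 0 < N) (Nat.add_left_cancel h)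
  refine (hinj.tsum_eq fun j hj => ⟨j / N, ?_⟩).symm
  have hmod : j % N = n := by
    have h : j ≡ n [MOD N] := by
      by_contra h
      exact hj (hf j h)
    exact Eq.trans h (Nat.mod_eq_of_lt hn)
  have := Nat.mod_add_div j N
  rwa [hmod] at this

theorem tsum_affine_mul_geometric {q : ℝ} (hq0 : 0 ≤ q) (hq1 : q < 1) (a b : ℝ) :
    ∑' k : ℕ, (a + b * k) * q ^ k = a * (1 - q)⁻¹ + b * (q / (1 - q) ^ 2) := by
  have hq : ‖q‖ < 1 := by rwa [Real.norm_of_nonneg hq0]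
  have h := ((hasSum_geometric_of_lt_one hq0 hq1).mul_left a).add
    ((hasSum_coe_mul_geometric_of_norm_lt_one hq).mul_left b)
  rw [← h.tsum_eq]
  exact tsum_congr fun k => by ring

theorem cat_coeff_eq {N : ℕ} (hN : 0 < N) (n j : ℕ) (Λ : ℂ) :
    ∑ m ∈ Finset.range N,
      Complex.exp (-(2 * (Real.pi : ℂ) * Complex.I * (m : ℂ) * (n : ℂ) / (N : ℂ))) *
        (Λ * Complex.exp (2 * (Real.pi : ℂ) * Complex.I * (m : ℂ) / (N : ℂ))) ^ j
      = Λ ^ j * if j ≡ n [MOD N] then (N : ℂ) else 0 := by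
  rw [← (Complex.isPrimitiveRoot_exp N hN.ne').sum_range_pow_mul_inv_pow, Finset.mul_sum]
  refine Finset.sum_congr rfl fun m _ => ?_
  simp only [mul_pow, ← Complex.exp_nat_mul, ← Complex.exp_neg]
  rw [mul_left_comm, ← Complex.exp_add, ← Complex.exp_add]
  congr 2
  ring


/-- For every positive integer `N`, integer `n` with `0 ≤ n ≤ N−1`, and complex
`Λ` with `0 < |Λ| < 1`, the mean excitation energy of the `N`-state Schrödinger cat
`Φ = ∑_{m=0}^{N−1} e^{−2πimn/N} Coh(Λe^{2πim/N})`, with `Δ_j`-coefficients `c j`, is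
`⟨Ê⟩_Φ = (∑_j j|c j|²)/(∑_j |c j|²) = (n + (N − n)|Λ|^{2N})/(1 − |Λ|^{2N})`. -/
theorem N_cat_mean_energy (N : ℕ) (hN : 0 < N) (n : ℕ) (hn : n < N)
    (Λ : ℂ) (h0 : Λ ≠ 0) (h1 : ‖Λ‖ < 1)
    (c : ℕ → ℂ)
    (hc : ∀ j : ℕ, c j = ∑ m ∈ Finset.range N,
      Complex.exp (-(2 * (Real.pi : ℂ) * Complex.I * (m : ℂ) * (n : ℂ) / (N : ℂ))) *
        (Λ * Complex.exp (2 * (Real.pi : ℂ) * Complex.I * (m : ℂ) / (N : ℂ))) ^ j) :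
    (∑' j : ℕ, (j : ℝ) * ‖c j‖ ^ 2) / (∑' j : ℕ, ‖c j‖ ^ 2)
      = ((n : ℝ) + ((N : ℝ) - (n : ℝ)) * ‖Λ‖ ^ (2 * N)) / (1 - ‖Λ‖ ^ (2 * N)) := by
  have hNR : (N : ℝ) ≠ 0 := by exact_mod_cast hN.ne'
  have hcj (j : ℕ) : c j = Λ ^ j * if j ≡ n [MOD N] then (N : ℂ) else 0 := by
    rw [hc, cat_coeff_eq hN]
  have hoff (j : ℕ) (hj : ¬ j ≡ n [MOD N]) : c j = 0 := by simp [hcj, hj]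
  set q : ℝ := ‖Λ‖ ^ (2 * N) with hq
  have hq0 : 0 ≤ q := by positivity
  have hq1 : q < 1 := pow_lt_one₀ (norm_nonneg _) h1 (by omega)
  set A : ℝ := (N : ℝ) ^ 2 * ‖Λ‖ ^ (2 * n) with hA
  have hA0 : A ≠ 0 := mul_ne_zero (pow_ne_zero _ hNR) (pow_ne_zero _ (norm_ne_zero_iff.2 h0))
  have hon (k : ℕ) : ‖c (n + N * k)‖ ^ 2 = A * q ^ k := by
    have hk : n + N * k ≡ n [MOD N] := by simp [Nat.ModEq]
    rw [hcj, if_pos hk, norm_mul, norm_pow, Complex.norm_natCast, hA, hq]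
    ring
  have hden : ∑' j, ‖c j‖ ^ 2 = A * (1 - q)⁻¹ := by
    rw [tsum_eq_tsum_add_mul_of_modEq hn _ fun j hj => by simp [hoff j hj]]
    simp only [hon]
    rw [tsum_mul_left, tsum_geometric_of_lt_one hq0 hq1]
  have hnum : ∑' j : ℕ, (j : ℝ) * ‖c j‖ ^ 2 =
      A * (n * (1 - q)⁻¹ + N * (q / (1 - q) ^ 2)) := by
    rw [tsum_eq_tsum_add_mul_of_modEq hn _ fun j hj => by simp [hoff j hj],
      ← tsum_affine_mul_geometric hq0 hq1, ← tsum_mul_left]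
    refine tsum_congr fun k => ?_
    rw [hon]
    push_cast
    ring
  have h1q : 1 - q ≠ 0 := (sub_pos.2 hq1).ne'
  rw [hnum, hden]
  field_simp
  ring
end

section
/- Fix a complex number Λ with 0 < |Λ| < 1 and a natural number n. For every integer N with N ≥ n + 1, let Φ_{N,n} ∈ ℓ²(ℕ, ℂ) be the unit-norm N-state Schrödinger cat, Φ_{N,n} = 𝒩_{N,n}^{−1/2} ∑_{m=0}^{N−1} e^{−2πimn/N} Coh(Λe^{2πim/N}) with 𝒩_{N,n} = N²|Λ|^{2n}/(1 − |Λ|^{2N}) its normalizing constant. Then the fidelity with the one-row Young tableau state satisfies F_N = |⟨Δ_n, Φ_{N,n}⟩| = √(1 − |Λ|^{2N}), and consequently F_N → 1 as N → ∞; i.e., the N-state Schrödinger cat approaches the one-row Young tableau state Δ_n with fidelity asymptotically reaching 1 at large N. -/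
open scoped ComplexInnerProductSpace

/-- The geometric sequence of ratio `w` with `‖w‖ < 1` is square summable. -/
theorem memℓp_two_pow {w : ℂ} (hw : ‖w‖ < 1) : Memℓp (fun j : ℕ => w ^ j) 2 := by
  refine memℓp_gen ?_
  have hs : Summable fun j : ℕ => (‖w‖ ^ 2) ^ j :=
    summable_geometric_of_lt_one (by positivity) (by nlinarith [norm_nonneg w])
  refine hs.congr fun j => ?_
  simp [norm_pow, ← pow_mul, mul_comm]

theorem norm_exp_two_pi_I_mul_div (m N : ℕ) :
    ‖Complex.exp (2 * (Real.pi : ℂ) * Complex.I * (m : ℂ) / (N : ℂ))‖ = 1 := by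
  rw [Complex.norm_exp]
  have h : 2 * (Real.pi : ℂ) * Complex.I * (m : ℂ) / (N : ℂ)
      = ((2 * Real.pi * m / N : ℝ) : ℂ) * Complex.I := by
    push_cast
    ring
  rw [h]
  simp only [Complex.re_ofReal_mul, Complex.I_re, mul_zero, Real.exp_zero]

theorem exp_neg_mul_mul_exp_pow (Λ : ℂ) (m n N : ℕ) :
    Complex.exp (-(2 * (Real.pi : ℂ) * Complex.I * (m : ℂ) * (n : ℂ) / (N : ℂ))) *
      (Λ * Complex.exp (2 * (Real.pi : ℂ) * Complex.I * (m : ℂ) / (N : ℂ))) ^ n = Λ ^ n := by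
  rw [mul_pow, ← Complex.exp_nat_mul, mul_left_comm, ← Complex.exp_add]
  have h : -(2 * (Real.pi : ℂ) * Complex.I * (m : ℂ) * (n : ℂ) / (N : ℂ)) +
      (n : ℂ) * (2 * (Real.pi : ℂ) * Complex.I * (m : ℂ) / (N : ℂ)) = 0 := by ring
  rw [h, Complex.exp_zero, mul_one]

theorem inv_sqrt_sq_mul_div_mul {a b c : ℝ} (ha : 0 < a) (hb : 0 < b) :
    (Real.sqrt (a ^ 2 * b ^ 2 / c))⁻¹ * (a * b) = Real.sqrt c := by
  have hab : 0 < a * b := mul_pos ha hb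
  rw [← mul_pow, Real.sqrt_div (by positivity), Real.sqrt_sq hab.le, inv_div,
    div_mul_cancel₀ _ hab.ne']

/-- Fix `Λ ∈ ℂ` with `0 < |Λ| < 1` and `n ∈ ℕ`.  For every `N ≥ n + 1`, the
unit-norm `N`-state Schrödinger cat
`Φ_{N,n} = 𝒩_{N,n}^{−1/2} ∑_{m=0}^{N−1} e^{−2πimn/N} Coh(Λe^{2πim/N}) ∈ ℓ²(ℕ, ℂ)`,
with `𝒩_{N,n} = N²|Λ|^{2n}/(1 − |Λ|^{2N})`, has fidelity
`F_N = |⟨Δ_n, Φ_{N,n}⟩| = √(1 − |Λ|^{2N})` with the one-row Young tableau state `Δ_n`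
(the `n`-th standard basis vector of `ℓ²(ℕ, ℂ)`), and consequently `F_N → 1` as `N → ∞`. -/
theorem N_cat_fidelity_to_young_tableau (Λ : ℂ) (h0 : Λ ≠ 0) (h1 : ‖Λ‖ < 1) (n : ℕ) :
    ∃ hmem : ∀ N : ℕ, Memℓp (fun j : ℕ =>
        ((Real.sqrt ((N : ℝ) ^ 2 * ‖Λ‖ ^ (2 * n) / (1 - ‖Λ‖ ^ (2 * N))) : ℝ) : ℂ)⁻¹ *
          ∑ m ∈ Finset.range N,
            Complex.exp (-(2 * (Real.pi : ℂ) * Complex.I * (m : ℂ) * (n : ℂ) / (N : ℂ))) *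
              (Λ * Complex.exp (2 * (Real.pi : ℂ) * Complex.I * (m : ℂ) / (N : ℂ))) ^ j) 2,
      (∀ N : ℕ, n + 1 ≤ N →
        ‖(⟪lp.single 2 n (1 : ℂ), (⟨_, hmem N⟩ : lp (fun _ : ℕ => ℂ) 2)⟫ : ℂ)‖
          = Real.sqrt (1 - ‖Λ‖ ^ (2 * N))) ∧
      Filter.Tendsto (fun N : ℕ =>
          ‖(⟪lp.single 2 n (1 : ℂ), (⟨_, hmem N⟩ : lp (fun _ : ℕ => ℂ) 2)⟫ : ℂ)‖)
        Filter.atTop (nhds 1) := by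
  have hmem : ∀ N : ℕ, Memℓp (fun j : ℕ =>
      ((Real.sqrt ((N : ℝ) ^ 2 * ‖Λ‖ ^ (2 * n) / (1 - ‖Λ‖ ^ (2 * N))) : ℝ) : ℂ)⁻¹ *
        ∑ m ∈ Finset.range N,
          Complex.exp (-(2 * (Real.pi : ℂ) * Complex.I * (m : ℂ) * (n : ℂ) / (N : ℂ))) *
            (Λ * Complex.exp (2 * (Real.pi : ℂ) * Complex.I * (m : ℂ) / (N : ℂ))) ^ j) 2 := by
    intro N
    refine Memℓp.const_mul (Memℓp.finsetSum _ fun m _ => Memℓp.const_mul (memℓp_two_pow ?_) _) _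
    rwa [norm_mul, norm_exp_two_pi_I_mul_div, mul_one]
  have hfid : ∀ N : ℕ, n + 1 ≤ N →
      ‖(⟪lp.single 2 n (1 : ℂ), (⟨_, hmem N⟩ : lp (fun _ : ℕ => ℂ) 2)⟫ : ℂ)‖
        = Real.sqrt (1 - ‖Λ‖ ^ (2 * N)) := by
    intro N hN
    have hN' : (0 : ℝ) < N := by exact_mod_cast (by lia : 0 < N)
    have hΛ : 0 < ‖Λ‖ ^ n := pow_pos (norm_pos_iff.mpr h0) n
    rw [lp.inner_single_left]
    simp only [exp_neg_mul_mul_exp_pow, Finset.sum_const, Finset.card_range, nsmul_eq_mul,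
      RCLike.inner_apply, map_one, mul_one, norm_mul, norm_inv, norm_pow, Complex.norm_real,
      Complex.norm_natCast, Real.norm_of_nonneg (Real.sqrt_nonneg _)]
    rw [mul_comm 2 n, pow_mul ‖Λ‖ n 2, inv_sqrt_sq_mul_div_mul hN' hΛ]
  refine ⟨hmem, hfid, ?_⟩
  have hpow : Filter.Tendsto (fun N : ℕ => ‖Λ‖ ^ (2 * N)) Filter.atTop (nhds 0) := by
    simp only [pow_mul]
    exact tendsto_pow_atTop_nhds_zero_of_lt_one (by positivity) (by nlinarith [norm_nonneg Λ])
  have hsqrt : Filter.Tendsto (fun N : ℕ => Real.sqrt (1 - ‖Λ‖ ^ (2 * N)))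
      Filter.atTop (nhds 1) := by
    simpa using (hpow.const_sub 1).sqrt
  refine hsqrt.congr' ?_
  filter_upwards [Filter.eventually_ge_atTop (n + 1)] with N hN
  exact (hfid N hN).symm
end

section
/- For every real x > 0: (∑_{m=0}^∞ (2m)² x^{2m}/(2m)!) / (∑_{m=0}^∞ x^{2m}/(2m)!) − (x·tanh x)² = x·tanh(x) + x²/cosh²(x), and (∑_{m=0}^∞ (2m+1)² x^{2m+1}/(2m+1)!) / (∑_{m=0}^∞ x^{2m+1}/(2m+1)!) − (x·coth x)² = x·coth(x) − x²/sinh²(x). Consequently, with x = |Λ_k|²/k, the energy variances of the giant-graviton cat states are (ΔE)²_{cat₊(Λ_k)} = k|Λ_k|² tanh(x) + |Λ_k|⁴ cosh(x)^{−2} and (ΔE)²_{cat₋(Λ_k)} = k|Λ_k|² coth(x) − |Λ_k|⁴ sinh(x)^{−2}. -/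
namespace Real

theorem hasSum_sinh_first_moment (x : ℝ) :
    HasSum (fun m : ℕ => ((2 * m + 1 : ℕ) : ℝ) * x ^ (2 * m + 1) / (Nat.factorial (2 * m + 1) : ℝ))
      (x * cosh x) := by
  refine HasSum.congr_fun ((hasSum_cosh x).mul_left x) fun m => ?_
  rw [Nat.factorial_succ]
  push_cast
  field_simp
  ring

theorem hasSum_cosh_first_moment (x : ℝ) :
    HasSum (fun m : ℕ => ((2 * m : ℕ) : ℝ) * x ^ (2 * m) / (Nat.factorial (2 * m) : ℝ))
      (x * sinh x) := by
  rw [← hasSum_nat_add_iff' 1]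
  simp only [Finset.range_one, Finset.sum_singleton, mul_zero, Nat.cast_zero, zero_mul, zero_div,
    sub_zero]
  refine HasSum.congr_fun ((hasSum_sinh x).mul_left x) fun m => ?_
  rw [show 2 * (m + 1) = 2 * m + 1 + 1 by ring, Nat.factorial_succ (2 * m + 1)]
  push_cast
  field_simp
  ring

theorem hasSum_sinh_second_moment (x : ℝ) :
    HasSum
      (fun m : ℕ => ((2 * m + 1 : ℕ) : ℝ) ^ 2 * x ^ (2 * m + 1) / (Nat.factorial (2 * m + 1) : ℝ))
      (x * cosh x + x ^ 2 * sinh x) := by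
  have h := ((hasSum_cosh x).mul_left x).add ((hasSum_cosh_first_moment x).mul_left x)
  rw [show x * (x * sinh x) = x ^ 2 * sinh x by ring] at h
  refine HasSum.congr_fun h fun m => ?_
  rw [Nat.factorial_succ]
  push_cast
  field_simp
  ring

theorem hasSum_cosh_second_moment (x : ℝ) :
    HasSum (fun m : ℕ => ((2 * m : ℕ) : ℝ) ^ 2 * x ^ (2 * m) / (Nat.factorial (2 * m) : ℝ))
      (x * sinh x + x ^ 2 * cosh x) := by
  have h := ((hasSum_sinh x).mul_left x).add ((hasSum_sinh_first_moment x).mul_left x)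
  rw [show x * (x * cosh x) = x ^ 2 * cosh x by ring] at h
  rw [← hasSum_nat_add_iff' 1]
  simp only [Finset.range_one, Finset.sum_singleton, mul_zero, Nat.cast_zero, zero_mul, zero_div,
    sub_zero, ne_eq, OfNat.ofNat_ne_zero, not_false_eq_true, zero_pow]
  refine HasSum.congr_fun h fun m => ?_
  rw [show 2 * (m + 1) = 2 * m + 1 + 1 by ring, Nat.factorial_succ (2 * m + 1)]
  push_cast
  field_simp
  ring

theorem cosh_variance_identity (x : ℝ) :
    (x * sinh x + x ^ 2 * cosh x) / cosh x - (x * tanh x) ^ 2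
      = x * tanh x + x ^ 2 / cosh x ^ 2 := by
  have hc := (cosh_pos x).ne'
  rw [tanh_eq_sinh_div_cosh]
  field_simp
  linear_combination x ^ 2 * cosh_sq x

theorem sinh_variance_identity {x : ℝ} (hx : x ≠ 0) :
    (x * cosh x + x ^ 2 * sinh x) / sinh x - (x * (cosh x / sinh x)) ^ 2
      = x * (cosh x / sinh x) - x ^ 2 / sinh x ^ 2 := by
  have hs := sinh_ne_zero.2 hx
  field_simp
  linear_combination -x * cosh_sq x

end Real

/-- For every real `x > 0`:
`(∑_m (2m)² x^{2m}/(2m)!)/(∑_m x^{2m}/(2m)!) − (x tanh x)² = x tanh x + x²/cosh² x` and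
`(∑_m (2m+1)² x^{2m+1}/(2m+1)!)/(∑_m x^{2m+1}/(2m+1)!) − (x coth x)² = x coth x − x²/sinh² x`.
Consequently, with `x = |Λ_k|²/k`, the energy variances of the giant-graviton cat states are
`(ΔE)²_{cat₊} = k|Λ_k|² tanh x + |Λ_k|⁴ cosh(x)⁻²` and
`(ΔE)²_{cat₋} = k|Λ_k|² coth x − |Λ_k|⁴ sinh(x)⁻²`. -/
theorem giant_graviton_cat_energy_variance (x : ℝ) (hx : 0 < x) :
    (∑' m : ℕ, ((2 * m : ℕ) : ℝ) ^ 2 * x ^ (2 * m) / (Nat.factorial (2 * m) : ℝ)) /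
          (∑' m : ℕ, x ^ (2 * m) / (Nat.factorial (2 * m) : ℝ))
        - (x * Real.tanh x) ^ 2
      = x * Real.tanh x + x ^ 2 / Real.cosh x ^ 2 ∧
    (∑' m : ℕ, ((2 * m + 1 : ℕ) : ℝ) ^ 2 * x ^ (2 * m + 1) / (Nat.factorial (2 * m + 1) : ℝ)) /
          (∑' m : ℕ, x ^ (2 * m + 1) / (Nat.factorial (2 * m + 1) : ℝ))
        - (x * (Real.cosh x / Real.sinh x)) ^ 2
      = x * (Real.cosh x / Real.sinh x) - x ^ 2 / Real.sinh x ^ 2 ∧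
    (∀ (k : ℝ) (Λk : ℂ), 0 < k → Λk ≠ 0 →
      (k ^ 2 * ((∑' m : ℕ, ((2 * m : ℕ) : ℝ) ^ 2 * (‖Λk‖ ^ 2 / k) ^ (2 * m) /
              (Nat.factorial (2 * m) : ℝ)) /
            (∑' m : ℕ, (‖Λk‖ ^ 2 / k) ^ (2 * m) / (Nat.factorial (2 * m) : ℝ))
          - ((∑' m : ℕ, ((2 * m : ℕ) : ℝ) * (‖Λk‖ ^ 2 / k) ^ (2 * m) /
              (Nat.factorial (2 * m) : ℝ)) /
            (∑' m : ℕ, (‖Λk‖ ^ 2 / k) ^ (2 * m) / (Nat.factorial (2 * m) : ℝ))) ^ 2)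
        = k * ‖Λk‖ ^ 2 * Real.tanh (‖Λk‖ ^ 2 / k)
            + ‖Λk‖ ^ 4 / Real.cosh (‖Λk‖ ^ 2 / k) ^ 2) ∧
      (k ^ 2 * ((∑' m : ℕ, ((2 * m + 1 : ℕ) : ℝ) ^ 2 * (‖Λk‖ ^ 2 / k) ^ (2 * m + 1) /
              (Nat.factorial (2 * m + 1) : ℝ)) /
            (∑' m : ℕ, (‖Λk‖ ^ 2 / k) ^ (2 * m + 1) / (Nat.factorial (2 * m + 1) : ℝ))
          - ((∑' m : ℕ, ((2 * m + 1 : ℕ) : ℝ) * (‖Λk‖ ^ 2 / k) ^ (2 * m + 1) /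
              (Nat.factorial (2 * m + 1) : ℝ)) /
            (∑' m : ℕ, (‖Λk‖ ^ 2 / k) ^ (2 * m + 1) / (Nat.factorial (2 * m + 1) : ℝ))) ^ 2)
        = k * ‖Λk‖ ^ 2 * (Real.cosh (‖Λk‖ ^ 2 / k) / Real.sinh (‖Λk‖ ^ 2 / k))
            - ‖Λk‖ ^ 4 / Real.sinh (‖Λk‖ ^ 2 / k) ^ 2)) := by
  simp only [(Real.hasSum_cosh _).tsum_eq, (Real.hasSum_sinh _).tsum_eq,
    (Real.hasSum_cosh_first_moment _).tsum_eq, (Real.hasSum_sinh_first_moment _).tsum_eq,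
    (Real.hasSum_cosh_second_moment _).tsum_eq, (Real.hasSum_sinh_second_moment _).tsum_eq]
  refine ⟨Real.cosh_variance_identity x, Real.sinh_variance_identity hx.ne', fun k Λk hk hΛ => ?_⟩
  have hy : ‖Λk‖ ^ 2 / k ≠ 0 := by positivity
  have hky : k * (‖Λk‖ ^ 2 / k) = ‖Λk‖ ^ 2 := by field_simp
  rw [show ‖Λk‖ ^ 4 = (‖Λk‖ ^ 2) ^ 2 by ring]
  generalize ‖Λk‖ ^ 2 / k = y at hy hky ⊢
  rw [← hky, mul_div_assoc y (Real.sinh y), mul_div_assoc y (Real.cosh y),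
    ← Real.tanh_eq_sinh_div_cosh, Real.cosh_variance_identity, Real.sinh_variance_identity hy]
  constructor <;> ring
end

section
/- Let H be a complex inner product space and let ψ₀, ψ₁ ∈ H be linearly independent unit vectors. Let η₀, η₁ > 0 with η₀ + η₁ = 1 and define the operator D : H → H by D x = η₁⟨ψ₁, x⟩ψ₁ − η₀⟨ψ₀, x⟩ψ₀. Then both numbers λ± = ½(η₁ − η₀ ± √(1 − 4η₀η₁|⟨ψ₀, ψ₁⟩|²)) are eigenvalues of D: there exist nonzero vectors v± in the span of {ψ₀, ψ₁} with D v± = λ± v±, and λ₊ ≥ 0 ≥ λ₋. -/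
open scoped ComplexInnerProductSpace

/-- Eigenvectors of a difference of two rank-one maps given by unit vectors, in coordinates
with respect to these vectors. -/
theorem rankOne_sub_rankOne_eigenvector {H : Type*} [NormedAddCommGroup H]
    [InnerProductSpace ℂ H] {ψ₀ ψ₁ : H} (h₀ : ‖ψ₀‖ = 1) (h₁ : ‖ψ₁‖ = 1)
    (hli : LinearIndependent ℂ ![ψ₀, ψ₁]) {p q μ a b : ℂ} (hab : b ≠ 0 ∨ a ≠ 0)
    (ha : q * (a + b * ⟪ψ₁, ψ₀⟫) = μ * a) (hb : -p * (a * ⟪ψ₀, ψ₁⟫ + b) = μ * b) :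
    ∃ v ∈ Submodule.span ℂ ({ψ₀, ψ₁} : Set H), v ≠ 0 ∧
      (q * ⟪ψ₁, v⟫) • ψ₁ - (p * ⟪ψ₀, v⟫) • ψ₀ = μ • v := by
  refine ⟨b • ψ₀ + a • ψ₁, Submodule.mem_span_pair.2 ⟨b, a, rfl⟩, fun h => ?_, ?_⟩
  · obtain ⟨hb0, ha0⟩ := LinearIndependent.pair_iff.1 hli b a h
    exact hab.elim (· hb0) (· ha0)
  · have e₀ : ⟪ψ₀, ψ₀⟫ = 1 := by simp [inner_self_eq_norm_sq_to_K, h₀]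
    have e₁ : ⟪ψ₁, ψ₁⟫ = 1 := by simp [inner_self_eq_norm_sq_to_K, h₁]
    simp only [inner_add_right, inner_smul_right, e₀, e₁]
    match_scalars
    · linear_combination ha
    · linear_combination hb

/-- Let `H` be a complex inner product space and `ψ₀, ψ₁ ∈ H` linearly
independent unit vectors; let `η₀, η₁ > 0` with `η₀ + η₁ = 1` and define
`D x = η₁⟨ψ₁, x⟩ψ₁ − η₀⟨ψ₀, x⟩ψ₀`.  Then both numbers
`λ± = ½(η₁ − η₀ ± √(1 − 4η₀η₁|⟨ψ₀, ψ₁⟩|²))` are eigenvalues of `D`: there exist nonzero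
vectors `v±` in the span of `{ψ₀, ψ₁}` with `D v± = λ± v±`, and `λ₊ ≥ 0 ≥ λ₋`. -/
theorem helstrom_operator_eigenvalues {H : Type*} [NormedAddCommGroup H]
    [InnerProductSpace ℂ H] (ψ₀ ψ₁ : H) (h₀ : ‖ψ₀‖ = 1) (h₁ : ‖ψ₁‖ = 1)
    (hli : LinearIndependent ℂ ![ψ₀, ψ₁])
    (η₀ η₁ : ℝ) (hη₀ : 0 < η₀) (hη₁ : 0 < η₁) (hsum : η₀ + η₁ = 1)
    (D : H → H)
    (hD : ∀ x : H, D x = ((η₁ : ℂ) * ⟪ψ₁, x⟫) • ψ₁ - ((η₀ : ℂ) * ⟪ψ₀, x⟫) • ψ₀)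
    (lamPlus lamMinus : ℝ)
    (hlamPlus : lamPlus = (η₁ - η₀ + Real.sqrt (1 - 4 * η₀ * η₁ * ‖⟪ψ₀, ψ₁⟫‖ ^ 2)) / 2)
    (hlamMinus : lamMinus = (η₁ - η₀ - Real.sqrt (1 - 4 * η₀ * η₁ * ‖⟪ψ₀, ψ₁⟫‖ ^ 2)) / 2) :
    (∃ v ∈ Submodule.span ℂ ({ψ₀, ψ₁} : Set H), v ≠ 0 ∧ D v = (lamPlus : ℂ) • v) ∧
    (∃ v ∈ Submodule.span ℂ ({ψ₀, ψ₁} : Set H), v ≠ 0 ∧ D v = (lamMinus : ℂ) • v) ∧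
    0 ≤ lamPlus ∧ lamMinus ≤ 0 := by
  set c := ⟪ψ₀, ψ₁⟫ with hc
  have hsc : ⟪ψ₁, ψ₀⟫ * c = ((‖c‖ ^ 2 : ℝ) : ℂ) := by
    rw [← inner_conj_symm ψ₁ ψ₀, ← hc, Complex.conj_mul']
    push_cast
    rfl
  have hc1 : ‖c‖ ≤ 1 := by simpa [h₀, h₁] using norm_inner_le_norm (𝕜 := ℂ) ψ₀ ψ₁
  have hc2 : ‖c‖ ^ 2 ≤ 1 := pow_le_one₀ (norm_nonneg c) hc1
  have hη : 0 < η₀ * η₁ := mul_pos hη₀ hη₁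
  have hdisc : (η₁ - η₀) ^ 2 ≤ 1 - 4 * η₀ * η₁ * ‖c‖ ^ 2 := by
    have hsq : (η₀ + η₁) ^ 2 = 1 := by rw [hsum, one_pow]
    nlinarith [mul_le_mul_of_nonneg_left hc2 hη.le]
  have habs := abs_le.1 (Real.abs_le_sqrt hdisc)
  have hsqrt := Real.sq_sqrt ((sq_nonneg _).trans hdisc)
  set r := Real.sqrt (1 - 4 * η₀ * η₁ * ‖c‖ ^ 2)
  have hplus : 0 ≤ lamPlus := by linarith [habs.1]
  have hminus : lamMinus ≤ 0 := by linarith [habs.2]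
  have hη₁' : η₁ = 1 - η₀ := by linarith
  have charPlus : (lamPlus - η₁) * (lamPlus + η₀) + η₀ * η₁ * ‖c‖ ^ 2 = 0 := by
    subst hlamPlus hη₁'
    linear_combination hsqrt / 4
  have charMinus : (lamMinus - η₁) * (lamMinus + η₀) + η₀ * η₁ * ‖c‖ ^ 2 = 0 := by
    subst hlamMinus hη₁'
    linear_combination hsqrt / 4
  have charPlus' := congrArg (fun x : ℝ => (x : ℂ)) charPlus
  have charMinus' := congrArg (fun x : ℝ => (x : ℂ)) charMinus
  push_cast at charPlus' charMinus' hsc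
  simp only [hD]
  refine ⟨rankOne_sub_rankOne_eigenvector h₀ h₁ hli
      (a := ((lamPlus + η₀ : ℝ) : ℂ)) (b := -(η₀ * c)) (Or.inr ?_) ?_ ?_,
    rankOne_sub_rankOne_eigenvector h₀ h₁ hli
      (a := η₁ * ⟪ψ₁, ψ₀⟫) (b := ((lamMinus - η₁ : ℝ) : ℂ)) (Or.inl ?_) ?_ ?_, hplus, hminus⟩
  · exact Complex.ofReal_ne_zero.2 (by linarith)
  · push_cast
    linear_combination -charPlus' - (η₀ : ℂ) * η₁ * hsc
  · push_cast
    ring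
  · exact Complex.ofReal_ne_zero.2 (by linarith)
  · push_cast
    ring
  · push_cast
    linear_combination -charMinus' - (η₀ : ℂ) * η₁ * hsc
end
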